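/- arXiv:2012.11208 — 3 statements merged into one kernel-verified Lean document; each statement's English description precedes it below -/
import Mathlib

section
/- For any constant incentive vector s̄ ∈ ℝ^N, every solution t ↦ (z_l(t), p(t)) of the BP dynamics with social influence with input s ≡ s̄ converges as t → ∞ to the point (z̄_l, p̄), where p̄ = (C + D + 𝓛)^{-1}(C p^ego + D p^bio) and z̄_l = p̄ − H s̄. -/
open Matrix Filter

/-- A nonnegative function with `W' ≤ -k W` for some `k > 0` tends to zero. -/
theorem tendsto_zero_of_deriv_le_neg_mul {W W' : ℝ → ℝ} {k : ℝ} (hk : 0 < k)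
    (hW0 : ∀ t, 0 ≤ W t) (hW : ∀ t, HasDerivAt W (W' t) t) (hle : ∀ t, W' t ≤ -k * W t) :
    Tendsto W atTop (nhds 0) := by
  have hder : ∀ t, HasDerivAt (fun τ => W τ * Real.exp (k * τ))
      ((W' t + k * W t) * Real.exp (k * t)) t := by
    intro t
    have h := (hW t).mul (((hasDerivAt_id t).const_mul k).exp)
    exact h.congr_deriv (by simp only [id]; ring)
  have hanti : Antitone fun τ => W τ * Real.exp (k * τ) := by
    refine antitone_of_deriv_nonpos (fun t => (hder t).differentiableAt) fun t => ?_
    rw [(hder t).deriv]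
    exact mul_nonpos_of_nonpos_of_nonneg (by linarith [hle t]) (Real.exp_pos _).le
  have hlim : Tendsto (fun t => W 0 * Real.exp (-(k * t))) atTop (nhds 0) := by
    have h := (Real.tendsto_exp_neg_atTop_nhds_zero.comp
      (tendsto_id.const_mul_atTop hk)).const_mul (W 0)
    simpa using h
  refine tendsto_of_tendsto_of_tendsto_of_le_of_le' tendsto_const_nhds hlim
    (Eventually.of_forall hW0) ?_
  filter_upwards [eventually_ge_atTop 0] with t ht
  have h := hanti ht
  simp only [mul_zero, Real.exp_zero, mul_one] at h
  rw [Real.exp_neg, ← div_eq_mul_inv, le_div_iff₀ (Real.exp_pos _)]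
  exact h

theorem laplacian_mulVec_apply {ι : Type*} [Fintype ι] [DecidableEq ι] {b : ι → ι → ℝ}
    {L : Matrix ι ι ℝ}
    (hL : ∀ i j, L i j = if i = j then ∑ k ∈ Finset.univ.erase i, b i k else -(b i j))
    (v : ι → ℝ) (i : ι) : (L *ᵥ v) i = ∑ j, b i j * (v i - v j) := by
  simp only [mulVec, dotProduct]
  rw [← Finset.add_sum_erase _ _ (Finset.mem_univ i),
    ← Finset.add_sum_erase _ (fun j => b i j * (v i - v j)) (Finset.mem_univ i), hL i i,
    if_pos rfl, Finset.sum_mul, ← Finset.sum_add_distrib, sub_self, mul_zero, zero_add]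
  refine Finset.sum_congr rfl fun j hj => ?_
  rw [hL i j, if_neg (Finset.ne_of_mem_erase hj).symm]
  ring

theorem laplacian_quadratic_form_nonneg {ι : Type*} [Fintype ι] [DecidableEq ι]
    {b : ι → ι → ℝ} (hb : ∀ i j, 0 ≤ b i j) (hbsym : ∀ i j, b i j = b j i)
    {L : Matrix ι ι ℝ}
    (hL : ∀ i j, L i j = if i = j then ∑ k ∈ Finset.univ.erase i, b i k else -(b i j))
    (v : ι → ℝ) : 0 ≤ ∑ i, v i * (L *ᵥ v) i := by
  have h1 : ∑ i, v i * (L *ᵥ v) i = ∑ i, ∑ j, b i j * (v i * (v i - v j)) := by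
    refine Finset.sum_congr rfl fun i _ => ?_
    rw [laplacian_mulVec_apply hL, Finset.mul_sum]
    exact Finset.sum_congr rfl fun j _ => by ring
  have h2 : ∑ i, v i * (L *ᵥ v) i = ∑ i, ∑ j, b i j * (v j * (v j - v i)) := by
    rw [h1, Finset.sum_comm]
    exact Finset.sum_congr rfl fun i _ => Finset.sum_congr rfl fun j _ => by rw [hbsym]
  have h3 : 0 ≤ ∑ i, ∑ j, b i j * (v i - v j) ^ 2 :=
    Finset.sum_nonneg fun i _ => Finset.sum_nonneg fun j _ => mul_nonneg (hb i j) (sq_nonneg _)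
  have h4 : ∑ i, ∑ j, b i j * (v i - v j) ^ 2 =
      ∑ i, v i * (L *ᵥ v) i + ∑ i, v i * (L *ᵥ v) i := by
    nth_rewrite 1 [h1]
    rw [h2]
    simp only [← Finset.sum_add_distrib]
    exact Finset.sum_congr rfl fun i _ => Finset.sum_congr rfl fun j _ => by ring
  linarith

theorem isUnit_det_diagonal_add_of_quadratic_form_nonneg {ι : Type*} [Fintype ι]
    [DecidableEq ι] {c d : ι → ℝ} (hcd : ∀ i, 0 < c i + d i) {L : Matrix ι ι ℝ}
    (hL : ∀ v : ι → ℝ, 0 ≤ ∑ i, v i * (L *ᵥ v) i) :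
    IsUnit (diagonal c + diagonal d + L).det := by
  rw [isUnit_iff_ne_zero]
  intro hdet
  obtain ⟨v, hv0, hv⟩ := exists_mulVec_eq_zero_iff.mpr hdet
  refine hv0 (funext fun i => ?_)
  have h1 : ∀ i, (c i + d i) * v i + (L *ᵥ v) i = 0 := by
    intro i
    have h := congrFun hv i
    simp only [add_mulVec, Pi.add_apply, mulVec_diagonal, Pi.zero_apply] at h
    linarith
  have h2 : ∑ i, (c i + d i) * v i ^ 2 = -∑ i, v i * (L *ᵥ v) i := by
    rw [← Finset.sum_neg_distrib]
    exact Finset.sum_congr rfl fun i _ => by linear_combination v i * h1 i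
  have h3 : ∀ i ∈ Finset.univ, 0 ≤ (c i + d i) * v i ^ 2 :=
    fun i _ => mul_nonneg (hcd i).le (sq_nonneg _)
  have h4 : ∑ i, (c i + d i) * v i ^ 2 = 0 :=
    le_antisymm (by linarith [hL v]) (Finset.sum_nonneg h3)
  have h5 := (Finset.sum_eq_zero_iff_of_nonneg h3).mp h4 i (Finset.mem_univ i)
  simpa [(hcd i).ne'] using h5

theorem exists_pos_forall_le {ι : Type*} [Finite ι] {f : ι → ℝ} (hf : ∀ i, 0 < f i) :
    ∃ m, 0 < m ∧ ∀ i, m ≤ f i := by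
  cases isEmpty_or_nonempty ι
  · exact ⟨1, one_pos, isEmptyElim⟩
  · obtain ⟨i, hi⟩ := Finite.exists_min f
    exact ⟨f i, hf i, hi⟩

theorem tendsto_of_tendsto_sum_sq {α ι : Type*} [Fintype ι] {l : Filter α}
    {f : α → ι → ℝ} {y : ι → ℝ}
    (hf : Tendsto (fun t => ∑ i, (f t i - y i) ^ 2) l (nhds 0)) (i : ι) :
    Tendsto (fun t => f t i) l (nhds (y i)) := by
  have h : Tendsto (fun t => (f t i - y i) ^ 2) l (nhds 0) :=
    squeeze_zero (fun t => sq_nonneg _) (fun t => Finset.single_le_sum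
      (f := fun j => (f t j - y j) ^ 2) (fun j _ => sq_nonneg _) (Finset.mem_univ i)) hf
  have h' := h.sqrt
  simp only [Real.sqrt_sq_eq_abs, Real.sqrt_zero] at h'
  exact tendsto_iff_norm_sub_tendsto_zero.mpr h'

/-- For any constant incentive s̄, every solution of the BP dynamics with
social influence with s ≡ s̄ converges to (z̄ₗ, p̄), where
p̄ = (C + D + 𝓛)⁻¹(C p^ego + D p^bio) and z̄ₗ = p̄ − H s̄. -/
theorem stmt_3 (N : ℕ) (hN : 1 ≤ N)
    (a h c d pego pbio : Fin N → ℝ)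
    (ha : ∀ i, 0 < a i) (hh : ∀ i, 0 ≤ h i ∧ h i ≤ 1)
    (hc : ∀ i, 0 ≤ c i) (hd : ∀ i, 0 ≤ d i) (hcd : ∀ i, 0 < c i + d i)
    (b : Fin N → Fin N → ℝ) (hb : ∀ i j, 0 ≤ b i j) (hbsym : ∀ i j, b i j = b j i)
    (L : Matrix (Fin N) (Fin N) ℝ)
    (hL : ∀ i j, L i j =
      if i = j then ∑ k ∈ Finset.univ.erase i, b i k else -(b i j))
    (sbar : Fin N → ℝ)
    (pbar zbar : Fin N → ℝ)
    (hpbar : pbar = (Matrix.diagonal c + Matrix.diagonal d + L)⁻¹ *ᵥ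
      (Matrix.diagonal c *ᵥ pego + Matrix.diagonal d *ᵥ pbio))
    (hzbar : ∀ i, zbar i = pbar i - h i * sbar i)
    (z p : ℝ → Fin N → ℝ)
    (hz : ∀ i t, HasDerivAt (fun τ => z τ i)
      (a i * (p t i - z t i - h i * sbar i)) t)
    (hp : ∀ i t, HasDerivAt (fun τ => p τ i)
      (c i * (pego i - p t i) + d i * (pbio i - p t i) - (L *ᵥ p t) i) t) :
    (∀ i, Tendsto (fun t => z t i) atTop (nhds (zbar i))) ∧
    (∀ i, Tendsto (fun t => p t i) atTop (nhds (pbar i))) := by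
  have hq := laplacian_quadratic_form_nonneg hb hbsym hL
  have heq : ∀ i, c i * (pego i - pbar i) + d i * (pbio i - pbar i) - (L *ᵥ pbar) i = 0 := by
    intro i
    have h := congrArg ((diagonal c + diagonal d + L) *ᵥ ·) hpbar
    simp only [mulVec_mulVec, mul_nonsing_inv _
      (isUnit_det_diagonal_add_of_quadratic_form_nonneg hcd hq), one_mulVec] at h
    have h := congrFun h i
    simp only [add_mulVec, Pi.add_apply, mulVec_diagonal] at h
    linarith
  obtain ⟨m₁, hm₁, hm₁a⟩ := exists_pos_forall_le ha
  obtain ⟨m₂, hm₂, hm₂cd⟩ := exists_pos_forall_le hcd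
  obtain ⟨κ, hκ, hκa⟩ := exists_pos_forall_le fun i => inv_pos.mpr (ha i)
  set m := min m₁ m₂ with hm_def
  have hm : 0 < m := lt_min hm₁ hm₂
  have hma : ∀ i, m ≤ a i := fun i => (min_le_left _ _).trans (hm₁a i)
  have hmcd : ∀ i, m ≤ c i + d i := fun i => (min_le_right _ _).trans (hm₂cd i)
  set ε := m * κ with hε_def
  have hε : 0 < ε := mul_pos hm hκ
  have hεa : ∀ i, ε * a i ≤ m := by
    intro i
    have h : κ * a i ≤ 1 := by
      simpa [(ha i).ne'] using mul_le_mul_of_nonneg_right (hκa i) (ha i).le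
    calc ε * a i = m * (κ * a i) := by rw [hε_def]; ring
      _ ≤ m := mul_le_of_le_one_right hm.le h
  have hsplit : ∀ t i, (L *ᵥ p t) i = (L *ᵥ (p t - pbar)) i + (L *ᵥ pbar) i := by
    intro t i
    rw [mulVec_sub, Pi.sub_apply, sub_add_cancel]
  have hW : ∀ t, HasDerivAt
      (fun τ => ∑ i, ((p τ i - pbar i) ^ 2 + ε * (z τ i - zbar i) ^ 2))
      (∑ i, (2 * (p t i - pbar i) *
          (-((c i + d i) * (p t i - pbar i)) - (L *ᵥ (p t - pbar)) i) +
        ε * (2 * (z t i - zbar i) *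
          (a i * ((p t i - pbar i) - (z t i - zbar i)))))) t := by
    intro t
    refine HasDerivAt.fun_sum fun i _ => ?_
    have h1 := ((hp i t).sub_const (pbar i)).pow 2
    have h2 := (((hz i t).sub_const (zbar i)).pow 2).const_mul ε
    refine (h1.add h2).congr_deriv ?_
    have e := heq i
    have s := hsplit t i
    rw [hzbar i]
    push_cast
    simp only [pow_one]
    linear_combination 2 * (p t i - pbar i) * e - 2 * (p t i - pbar i) * s
  have hlim := tendsto_zero_of_deriv_le_neg_mul hm
    (fun t => Finset.sum_nonneg fun i _ => by positivity) hW fun t => by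
      have hqt := hq (p t - pbar)
      have hterm : ∀ i ∈ Finset.univ,
          2 * (p t i - pbar i) *
              (-((c i + d i) * (p t i - pbar i)) - (L *ᵥ (p t - pbar)) i) +
            ε * (2 * (z t i - zbar i) * (a i * ((p t i - pbar i) - (z t i - zbar i)))) ≤
          -m * ((p t i - pbar i) ^ 2 + ε * (z t i - zbar i) ^ 2) +
            -2 * ((p t - pbar) i * (L *ᵥ (p t - pbar)) i) := by
        intro i _
        rw [Pi.sub_apply]
        generalize p t i - pbar i = e
        generalize z t i - zbar i = w
        have h1 := mul_nonneg (sub_nonneg.mpr (hmcd i)) (sq_nonneg e)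
        have h2 := mul_nonneg (mul_nonneg hε.le (sub_nonneg.mpr (hma i))) (sq_nonneg w)
        have h3 := mul_nonneg (mul_nonneg hε.le (ha i).le) (sq_nonneg (e - w))
        have h4 := mul_nonneg (sub_nonneg.mpr (hεa i)) (sq_nonneg e)
        nlinarith
      refine (Finset.sum_le_sum hterm).trans ?_
      rw [Finset.sum_add_distrib, ← Finset.mul_sum, ← Finset.mul_sum]
      linarith
  refine ⟨tendsto_of_tendsto_sum_sq ?_, tendsto_of_tendsto_sum_sq ?_⟩
  · have h := hlim.const_mul ε⁻¹
    rw [mul_zero] at h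
    refine squeeze_zero (fun t => Finset.sum_nonneg fun i _ => sq_nonneg _) (fun t => ?_) h
    rw [Finset.mul_sum]
    refine Finset.sum_le_sum fun i _ => ?_
    rw [mul_add, inv_mul_cancel_left₀ hε.ne']
    exact le_add_of_nonneg_left (by positivity)
  · refine squeeze_zero (fun t => Finset.sum_nonneg fun i _ => sq_nonneg _) (fun t => ?_) hlim
    exact Finset.sum_le_sum fun i _ => le_add_of_nonneg_right (by positivity)
end

section
/- The social-physical welfare optimization problem (P) admits exactly one global minimizer (ẑ, Î_td, Î_tq, û_d, û_q, V̂_d, ŝ) ∈ ℝ^{7N}. -/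
open Matrix

/-- The optimization variables (z, I_td, I_tq, u_d, u_q, V_d, s) ∈ ℝ^{7N} of problem (P). -/
structure PVars (N : ℕ) where
  z : Fin N → ℝ
  Itd : Fin N → ℝ
  Itq : Fin N → ℝ
  ud : Fin N → ℝ
  uq : Fin N → ℝ
  Vd : Fin N → ℝ
  s : Fin N → ℝ

/-- Feasibility: the linear equality constraints (b)–(f) of problem (P). -/
def PFeas {N E : ℕ} (ω : ℝ) (ILd ILq rLinv Ct Rt Lt h : Fin N → ℝ)
    (B : Matrix (Fin N) (Fin E) ℝ) (J K : Matrix (Fin E) (Fin N) ℝ)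
    (pbar : Fin N → ℝ) (x : PVars N) : Prop :=
  (∀ i, ILd i * x.z i - x.Itd i + rLinv i * x.Vd i - ((B * J) *ᵥ x.Vd) i = 0) ∧
  (∀ i, ILq i * x.z i - x.Itq i + ω * Ct i * x.Vd i - ((B * K) *ᵥ x.Vd) i = 0) ∧
  (∀ i, x.Vd i + Rt i * x.Itd i - ω * Lt i * x.Itq i - x.ud i = 0) ∧
  (∀ i, -(ω * Lt i * x.Itd i) - Rt i * x.Itq i + x.uq i = 0) ∧
  (∀ i, pbar i - x.z i - h i * x.s i = 0)

/-- The objective function F of problem (P). -/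
noncomputable def PObj {N : ℕ} (α β γ δ ε η : ℝ) (πu πc IL Vr : Fin N → ℝ) (x : PVars N) : ℝ :=
  α / 2 * ∑ i, πu i * IL i ^ 2 * (1 - x.z i) ^ 2
  + β / 2 * ∑ i, πc i * x.Itd i ^ 2
  + γ / 2 * ∑ i, x.ud i ^ 2
  + δ / 2 * ∑ i, x.uq i ^ 2
  + ε / 2 * ∑ i, (x.Vd i - Vr i) ^ 2
  + η / 2 * ∑ i, x.s i ^ 2

/-- The constraints of problem (P) determine every variable from `V_d` and `s`. -/
def PVars.ofFree {N E : ℕ} (ω : ℝ) (ILd ILq rLinv Ct Rt Lt h : Fin N → ℝ)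
    (B : Matrix (Fin N) (Fin E) ℝ) (J K : Matrix (Fin E) (Fin N) ℝ)
    (pbar : Fin N → ℝ) (q : (Fin N → ℝ) × (Fin N → ℝ)) : PVars N :=
  let z : Fin N → ℝ := fun i => pbar i - h i * q.2 i
  let Itd : Fin N → ℝ := fun i => ILd i * z i + rLinv i * q.1 i - ((B * J) *ᵥ q.1) i
  let Itq : Fin N → ℝ := fun i => ILq i * z i + ω * Ct i * q.1 i - ((B * K) *ᵥ q.1) i
  { z := z
    Itd := Itd
    Itq := Itq
    ud := fun i => q.1 i + Rt i * Itd i - ω * Lt i * Itq i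
    uq := fun i => ω * Lt i * Itd i + Rt i * Itq i
    Vd := q.1
    s := q.2 }

theorem pFeas_iff_eq_ofFree {N E : ℕ} (ω : ℝ) (ILd ILq rLinv Ct Rt Lt h : Fin N → ℝ)
    (B : Matrix (Fin N) (Fin E) ℝ) (J K : Matrix (Fin E) (Fin N) ℝ)
    (pbar : Fin N → ℝ) (x : PVars N) :
    PFeas ω ILd ILq rLinv Ct Rt Lt h B J K pbar x ↔
      x = PVars.ofFree ω ILd ILq rLinv Ct Rt Lt h B J K pbar (x.Vd, x.s) := by
  constructor
  · rintro ⟨hb, hc, hd, he, hf⟩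
    obtain ⟨z, Itd, Itq, ud, uq, Vd, s⟩ := x
    dsimp only at hb hc hd he hf
    obtain rfl : z = fun i => pbar i - h i * s i := by
      funext i
      linarith [hf i]
    obtain rfl : Itd = fun i => ILd i * (pbar i - h i * s i) + rLinv i * Vd i
        - ((B * J) *ᵥ Vd) i := by
      funext i
      linarith [hb i]
    obtain rfl : Itq = fun i => ILq i * (pbar i - h i * s i) + ω * Ct i * Vd i
        - ((B * K) *ᵥ Vd) i := by
      funext i
      linarith [hc i]
    simp only [PVars.ofFree, PVars.mk.injEq, true_and, and_true]
    constructor <;> funext i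
    · linarith [hd i]
    · linarith [he i]
  · intro hx
    rw [hx]
    refine ⟨fun i => ?_, fun i => ?_, fun i => ?_, fun i => ?_, fun i => ?_⟩ <;>
      · simp only [PVars.ofFree]
        ring

/-- The midpoint of two points of `ℝ^{7N}`. -/
noncomputable def PVars.mid {N : ℕ} (x y : PVars N) : PVars N where
  z i := (x.z i + y.z i) / 2
  Itd i := (x.Itd i + y.Itd i) / 2
  Itq i := (x.Itq i + y.Itq i) / 2
  ud i := (x.ud i + y.ud i) / 2
  uq i := (x.uq i + y.uq i) / 2
  Vd i := (x.Vd i + y.Vd i) / 2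
  s i := (x.s i + y.s i) / 2

theorem PFeas.mid {N E : ℕ} {ω : ℝ} {ILd ILq rLinv Ct Rt Lt h : Fin N → ℝ}
    {B : Matrix (Fin N) (Fin E) ℝ} {J K : Matrix (Fin E) (Fin N) ℝ}
    {pbar : Fin N → ℝ} {x y : PVars N}
    (hx : PFeas ω ILd ILq rLinv Ct Rt Lt h B J K pbar x)
    (hy : PFeas ω ILd ILq rLinv Ct Rt Lt h B J K pbar y) :
    PFeas ω ILd ILq rLinv Ct Rt Lt h B J K pbar (x.mid y) := by
  have mulVec_mid (M : Matrix (Fin N) (Fin N) ℝ) (i : Fin N) :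
      (M *ᵥ (x.mid y).Vd) i = ((M *ᵥ x.Vd) i + (M *ᵥ y.Vd) i) / 2 := by
    have : (x.mid y).Vd = (1 / 2 : ℝ) • (x.Vd + y.Vd) := by
      funext i
      simp only [PVars.mid, Pi.smul_apply, Pi.add_apply, smul_eq_mul]
      ring
    rw [this, mulVec_smul, mulVec_add]
    simp only [Pi.smul_apply, Pi.add_apply, smul_eq_mul]
    ring
  obtain ⟨xb, xc, xd, xe, xf⟩ := hx
  obtain ⟨yb, yc, yd, ye, yf⟩ := hy
  refine ⟨fun i => ?_, fun i => ?_, fun i => ?_, fun i => ?_, fun i => ?_⟩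
  · rw [mulVec_mid]
    simp only [PVars.mid]
    linear_combination (xb i + yb i) / 2
  · rw [mulVec_mid]
    simp only [PVars.mid]
    linear_combination (xc i + yc i) / 2
  · simp only [PVars.mid]
    linear_combination (xd i + yd i) / 2
  · simp only [PVars.mid]
    linear_combination (xe i + ye i) / 2
  · simp only [PVars.mid]
    linear_combination (xf i + yf i) / 2

theorem sum_mul_sq_midpoint {ι : Type*} [Fintype ι] (w a b : ι → ℝ) :
    ∑ i, w i * ((a i + b i) / 2) ^ 2 + (∑ i, w i * (a i - b i) ^ 2) / 4 =
      (∑ i, w i * a i ^ 2 + ∑ i, w i * b i ^ 2) / 2 := by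
  rw [Finset.sum_div, ← Finset.sum_add_distrib, ← Finset.sum_add_distrib, Finset.sum_div]
  exact Finset.sum_congr rfl fun i _ => by ring

theorem sum_mul_sq_midpoint_le {ι : Type*} [Fintype ι] {w : ι → ℝ} (hw : ∀ i, 0 ≤ w i)
    (a b : ι → ℝ) :
    ∑ i, w i * ((a i + b i) / 2) ^ 2 ≤
      (∑ i, w i * a i ^ 2 + ∑ i, w i * b i ^ 2) / 2 := by
  have : 0 ≤ ∑ i, w i * (a i - b i) ^ 2 :=
    Finset.sum_nonneg fun i _ => mul_nonneg (hw i) (sq_nonneg _)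
  linarith [sum_mul_sq_midpoint w a b]

section Objective

variable {N : ℕ} {α β γ δ ε η : ℝ} {πu πc IL : Fin N → ℝ}

/-- Strong convexity of the objective in `V_d` and `s`, at midpoints. -/
theorem pObj_mid_add_le (hα : 0 ≤ α) (hβ : 0 ≤ β) (hγ : 0 ≤ γ) (hδ : 0 ≤ δ)
    (hπu : ∀ i, 0 ≤ πu i) (hπc : ∀ i, 0 ≤ πc i) (Vr : Fin N → ℝ) (x y : PVars N) :
    PObj α β γ δ ε η πu πc IL Vr (x.mid y)
        + ε / 8 * ∑ i, (x.Vd i - y.Vd i) ^ 2 + η / 8 * ∑ i, (x.s i - y.s i) ^ 2 ≤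
      (PObj α β γ δ ε η πu πc IL Vr x + PObj α β γ δ ε η πu πc IL Vr y) / 2 := by
  have z_le := sum_mul_sq_midpoint_le (fun i => mul_nonneg (hπu i) (sq_nonneg (IL i)))
    (fun i => 1 - x.z i) (fun i => 1 - y.z i)
  have z_mid (i : Fin N) : (1 - x.z i + (1 - y.z i)) / 2 = 1 - (x.z i + y.z i) / 2 := by ring
  have Itd_le := sum_mul_sq_midpoint_le hπc x.Itd y.Itd
  have ud_le := sum_mul_sq_midpoint_le (fun _ => zero_le_one) x.ud y.ud
  have uq_le := sum_mul_sq_midpoint_le (fun _ => zero_le_one) x.uq y.uq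
  have Vd_eq := sum_mul_sq_midpoint (fun _ => 1)
    (fun i => x.Vd i - Vr i) (fun i => y.Vd i - Vr i)
  have Vd_mid (i : Fin N) :
      (x.Vd i - Vr i + (y.Vd i - Vr i)) / 2 = (x.Vd i + y.Vd i) / 2 - Vr i := by ring
  have s_eq := sum_mul_sq_midpoint (fun _ => 1) x.s y.s
  simp only [z_mid, Vd_mid, one_mul, sub_sub_sub_cancel_right] at *
  simp only [PObj, PVars.mid]
  linear_combination α / 2 * z_le + β / 2 * Itd_le + γ / 2 * ud_le + δ / 2 * uq_le
    + ε / 2 * Vd_eq + η / 2 * s_eq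

theorem le_pObj (hα : 0 ≤ α) (hβ : 0 ≤ β) (hγ : 0 ≤ γ) (hδ : 0 ≤ δ)
    (hπu : ∀ i, 0 ≤ πu i) (hπc : ∀ i, 0 ≤ πc i) (Vr : Fin N → ℝ) (x : PVars N) :
    ε / 2 * ∑ i, (x.Vd i - Vr i) ^ 2 + η / 2 * ∑ i, x.s i ^ 2 ≤
      PObj α β γ δ ε η πu πc IL Vr x := by
  have z_nonneg : 0 ≤ α / 2 * ∑ i, πu i * IL i ^ 2 * (1 - x.z i) ^ 2 :=
    mul_nonneg (by positivity) (Finset.sum_nonneg fun i _ => by have := hπu i; positivity)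
  have Itd_nonneg : 0 ≤ β / 2 * ∑ i, πc i * x.Itd i ^ 2 :=
    mul_nonneg (by positivity) (Finset.sum_nonneg fun i _ => by have := hπc i; positivity)
  have ud_nonneg : 0 ≤ γ / 2 * ∑ i, x.ud i ^ 2 := by positivity
  have uq_nonneg : 0 ≤ δ / 2 * ∑ i, x.uq i ^ 2 := by positivity
  simp only [PObj]
  linarith

/-- Sublevel sets of the objective are bounded in `V_d` and `s`. -/
theorem exists_mem_Icc_of_pObj_le (hα : 0 ≤ α) (hβ : 0 ≤ β) (hγ : 0 ≤ γ) (hδ : 0 ≤ δ)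
    (hε : 0 < ε) (hη : 0 < η) (hπu : ∀ i, 0 ≤ πu i) (hπc : ∀ i, 0 ≤ πc i)
    (Vr : Fin N → ℝ) (c : ℝ) :
    ∃ a b : (Fin N → ℝ) × (Fin N → ℝ), ∀ x : PVars N,
      PObj α β γ δ ε η πu πc IL Vr x ≤ c → (x.Vd, x.s) ∈ Set.Icc a b := by
  refine ⟨(fun i => Vr i - √(c / (ε / 2)), fun _ => -√(c / (η / 2))),
    (fun i => Vr i + √(c / (ε / 2)), fun _ => √(c / (η / 2))), fun x hx => ?_⟩
  have lower := le_pObj (ε := ε) (η := η) (IL := IL) hα hβ hγ hδ hπu hπc Vr x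
  have Vd_nonneg : 0 ≤ ε / 2 * ∑ i, (x.Vd i - Vr i) ^ 2 := by positivity
  have s_nonneg : 0 ≤ η / 2 * ∑ i, x.s i ^ 2 := by positivity
  have Vd_abs (i : Fin N) : |x.Vd i - Vr i| ≤ √(c / (ε / 2)) := by
    refine Real.abs_le_sqrt ?_
    rw [le_div_iff₀' (by positivity)]
    have := mul_le_mul_of_nonneg_left (Finset.single_le_sum
      (f := fun i => (x.Vd i - Vr i) ^ 2) (fun j _ => sq_nonneg _) (Finset.mem_univ i))
      (half_pos hε).le
    linarith
  have s_abs (i : Fin N) : |x.s i| ≤ √(c / (η / 2)) := by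
    refine Real.abs_le_sqrt ?_
    rw [le_div_iff₀' (by positivity)]
    have := mul_le_mul_of_nonneg_left (Finset.single_le_sum
      (f := fun i => x.s i ^ 2) (fun j _ => sq_nonneg _) (Finset.mem_univ i))
      (half_pos hη).le
    linarith
  exact ⟨⟨fun i => by linarith [(abs_le.mp (Vd_abs i)).1], fun i => (abs_le.mp (s_abs i)).1⟩,
    ⟨fun i => by linarith [(abs_le.mp (Vd_abs i)).2], fun i => (abs_le.mp (s_abs i)).2⟩⟩

end Objective

theorem continuous_pObj_ofFree {N E : ℕ} (α β γ δ ε η ω : ℝ)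
    (ILd ILq rLinv Ct Rt Lt h : Fin N → ℝ)
    (B : Matrix (Fin N) (Fin E) ℝ) (J K : Matrix (Fin E) (Fin N) ℝ)
    (Vr pbar πu πc IL : Fin N → ℝ) :
    Continuous fun q => PObj α β γ δ ε η πu πc IL Vr
      (PVars.ofFree ω ILd ILq rLinv Ct Rt Lt h B J K pbar q) := by
  simp only [PObj, PVars.ofFree, mulVec, dotProduct]
  fun_prop

theorem eq_of_sum_sub_sq_eq_zero {ι : Type*} [Fintype ι] {a b : ι → ℝ}
    (hab : ∑ i, (a i - b i) ^ 2 = 0) : a = b := by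
  funext i
  have := (Finset.sum_eq_zero_iff_of_nonneg fun i _ => sq_nonneg (a i - b i)).mp hab i
    (Finset.mem_univ i)
  exact sub_eq_zero.mp (pow_eq_zero_iff two_ne_zero |>.mp this)

/-- The social-physical welfare optimization problem (P) admits exactly one
global minimizer in ℝ^{7N}. -/
theorem stmt_9 (N E : ℕ) (hN : 1 ≤ N) (hE : 1 ≤ E)
    (α β γ δ ε η ω : ℝ) (hα : 0 < α) (hβ : 0 < β) (hγ : 0 < γ) (hδ : 0 < δ)
    (hε : 0 < ε) (hη : 0 < η)
    (ILd ILq rLinv Ct Rt Lt h : Fin N → ℝ)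
    (hRt : ∀ i, 0 < Rt i) (hh : ∀ i, 0 ≤ h i ∧ h i ≤ 1)
    (B : Matrix (Fin N) (Fin E) ℝ) (J K : Matrix (Fin E) (Fin N) ℝ)
    (Vr pbar : Fin N → ℝ)
    (πu πc IL : Fin N → ℝ)
    (hπu : ∀ i, 0 < πu i) (hπc : ∀ i, 0 < πc i) (hIL : ∀ i, 0 < IL i) :
    ∃! x : PVars N, PFeas ω ILd ILq rLinv Ct Rt Lt h B J K pbar x ∧
      ∀ y : PVars N, PFeas ω ILd ILq rLinv Ct Rt Lt h B J K pbar y →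
        PObj α β γ δ ε η πu πc IL Vr x ≤ PObj α β γ δ ε η πu πc IL Vr y := by
  have hα' := hα.le
  have hβ' := hβ.le
  have hγ' := hγ.le
  have hδ' := hδ.le
  have hπu' := fun i => (hπu i).le
  have hπc' := fun i => (hπc i).le
  have feas_iff := pFeas_iff_eq_ofFree ω ILd ILq rLinv Ct Rt Lt h B J K pbar
  set p := PVars.ofFree ω ILd ILq rLinv Ct Rt Lt h B J K pbar
  have feas (q : (Fin N → ℝ) × (Fin N → ℝ)) :
      PFeas ω ILd ILq rLinv Ct Rt Lt h B J K pbar (p q) := (feas_iff _).mpr rfl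
  have cont := continuous_pObj_ofFree α β γ δ ε η ω ILd ILq rLinv Ct Rt Lt h B J K Vr pbar
    πu πc IL
  obtain ⟨a, b, hab⟩ := exists_mem_Icc_of_pObj_le (IL := IL) hα' hβ' hγ' hδ' hε hη hπu' hπc' Vr
    (PObj α β γ δ ε η πu πc IL Vr (p 0))
  obtain ⟨q, -, hq⟩ := (isCompact_Icc (a := a) (b := b)).exists_isMinOn
    ⟨0, hab (p 0) le_rfl⟩ cont.continuousOn
  have minimal (y : PVars N) (hy : PFeas ω ILd ILq rLinv Ct Rt Lt h B J K pbar y) :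
      PObj α β γ δ ε η πu πc IL Vr (p q) ≤ PObj α β γ δ ε η πu πc IL Vr y := by
    rw [(feas_iff y).mp hy]
    rcases le_total (PObj α β γ δ ε η πu πc IL Vr (p (y.Vd, y.s)))
      (PObj α β γ δ ε η πu πc IL Vr (p 0)) with hle | hle
    · exact hq (hab (p (y.Vd, y.s)) hle)
    · exact (hq (hab (p 0) le_rfl)).trans hle
  refine ⟨p q, ⟨feas q, minimal⟩, fun y ⟨hy, hymin⟩ => ?_⟩
  have convex := pObj_mid_add_le (ε := ε) (η := η) (IL := IL) hα' hβ' hγ' hδ' hπu' hπc' Vr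
    (p q) y
  have mid_ge := hymin _ ((feas q).mid hy)
  have p_le := minimal y hy
  have Vd_nonneg : 0 ≤ ε / 8 * ∑ i, ((p q).Vd i - y.Vd i) ^ 2 := by positivity
  have s_nonneg : 0 ≤ η / 8 * ∑ i, ((p q).s i - y.s i) ^ 2 := by positivity
  have Vd_zero : ε / 8 * ∑ i, ((p q).Vd i - y.Vd i) ^ 2 = 0 := by linarith
  have s_zero : η / 8 * ∑ i, ((p q).s i - y.s i) ^ 2 = 0 := by linarith
  have Vd_eq := eq_of_sum_sub_sq_eq_zero ((mul_eq_zero_iff_left (by positivity)).mp Vd_zero)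
  have s_eq := eq_of_sum_sub_sq_eq_zero ((mul_eq_zero_iff_left (by positivity)).mp s_zero)
  rw [(feas_iff y).mp hy, (feas_iff (p q)).mp (feas q), Vd_eq, s_eq]
end

section
/- There exist positive reals ζ₁, ζ₂, ζ₃ and diagonal positive definite matrices Q₁, Q₂ (with P₁, P₂ the unique solutions of −Aᵀ P₁ − P₁ A + Q₁ = 0 and −(C+D)ᵀ P₂ − P₂ (C+D) + Q₂ = 0) such that, along every twice continuously differentiable solution of the human-physical system driven by continuously differentiable inputs u_d, u_q, s : ℝ → ℝ^N, the storage function S_ph = ½(V̇_dᵀ C_t V̇_d + V̇_qᵀ C_t V̇_q + İ_tdᵀ L_t İ_td + İ_tqᵀ L_t İ_tq + İ_dᵀ L İ_d + İ_qᵀ L İ_q) + ż_lᵀ P₁ ż_l + ṗ̃ᵀ P₂ ṗ̃ satisfies d/dt S_ph ≤ İ_tdᵀ u̇_d + İ_tqᵀ u̇_q − 2 ż_lᵀ P₁ A H ṡ; i.e. the human-physical system is passive with respect to the supply rate [İ_tdᵀ, İ_tqᵀ, −2 ż_lᵀ P₁ A H][u̇_dᵀ, u̇_qᵀ, ṡᵀ]ᵀ.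 -/
open Matrix

/-- A diagonal Lyapunov equation with positive diagonal coefficients has only the diagonal
solution. -/
lemma eq_diagonal_of_lyapunov {n : Type*} [Fintype n] [DecidableEq n] {a q : n → ℝ}
    (ha : ∀ i, 0 < a i) {P : Matrix n n ℝ}
    (h : -(diagonal a)ᵀ * P - P * diagonal a + diagonal q = 0) :
    P = diagonal (fun i => q i / (2 * a i)) := by
  ext i j
  have hij := congrFun (congrFun h i) j
  have hi := ha i
  have hj := ha j
  simp only [diagonal_transpose, Matrix.add_apply, Matrix.sub_apply, Matrix.neg_mul,
    Matrix.neg_apply, diagonal_mul, mul_diagonal, Matrix.zero_apply] at hij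
  rcases eq_or_ne i j with rfl | hne
  · simp only [diagonal_apply_eq] at hij ⊢
    field_simp
    linarith
  · simp only [diagonal_apply_ne _ hne] at hij ⊢
    have : (a i + a j) * P i j = 0 := by linarith
    exact (mul_eq_zero.1 this).resolve_left (by positivity)

lemma hasDerivAt_of_contDiff_one {f : ℝ → ℝ} (hf : ContDiff ℝ 1 f) (t : ℝ) :
    HasDerivAt f (deriv f t) t :=
  (hf.differentiable one_ne_zero t).hasDerivAt

lemma hasDerivAt_of_contDiff_two {f : ℝ → ℝ} (hf : ContDiff ℝ 2 f) (t : ℝ) :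
    HasDerivAt f (deriv f t) t :=
  (hf.differentiable two_ne_zero t).hasDerivAt

lemma hasDerivAt_deriv_of_contDiff_two {f : ℝ → ℝ} (hf : ContDiff ℝ 2 f) (t : ℝ) :
    HasDerivAt (deriv f) (deriv (deriv f) t) t :=
  hasDerivAt_of_contDiff_one ((contDiff_succ_iff_deriv (n := 1)).1 hf).2.2 t

lemma hasDerivAt_mulVec_apply {m n : Type*} [Fintype n] (B : Matrix m n ℝ)
    {x : ℝ → n → ℝ} {x' : n → ℝ} {t : ℝ} (hx : ∀ k, HasDerivAt (fun τ => x τ k) (x' k) t)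
    (i : m) : HasDerivAt (fun τ => (B *ᵥ x τ) i) ((B *ᵥ x') i) t := by
  simp only [mulVec, dotProduct]
  exact HasDerivAt.fun_sum fun k _ => (hx k).const_mul (B i k)

lemma mul_deriv_deriv_eq {f g : ℝ → ℝ} {c g' t : ℝ} (hf : ContDiff ℝ 2 f)
    (h : ∀ τ, c * deriv f τ = g τ) (hg : HasDerivAt g g' t) :
    c * deriv (deriv f) t = g' := by
  have h1 := (hasDerivAt_deriv_of_contDiff_two hf t).const_mul c
  rw [funext h] at h1
  exact h1.unique hg

lemma hasDerivAt_sum_mul_sq {n : Type*} [Fintype n] (c : n → ℝ) {x : ℝ → n → ℝ} {x' : n → ℝ}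
    {t : ℝ} (hx : ∀ i, HasDerivAt (fun τ => x τ i) (x' i) t) :
    HasDerivAt (fun τ => ∑ i, c i * x τ i ^ 2) (∑ i, 2 * (x t i * (c i * x' i))) t := by
  refine HasDerivAt.fun_sum fun i _ => ?_
  refine (((hx i).fun_pow 2).const_mul (c i)).congr_deriv ?_
  push_cast
  ring

lemma sum_sum_mul_diagonal_mul {n : Type*} [Fintype n] [DecidableEq n] (p x y : n → ℝ) :
    ∑ i, ∑ j, x i * diagonal p i j * y j = ∑ i, x i * p i * y i := by
  simp [diagonal_apply]

lemma sum_mul_mulVec_transpose {m n : Type*} [Fintype m] [Fintype n] (B : Matrix m n ℝ)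
    (x : m → ℝ) (y : n → ℝ) : ∑ k, y k * (Bᵀ *ᵥ x) k = ∑ i, x i * (B *ᵥ y) i := by
  change y ⬝ᵥ (Bᵀ *ᵥ x) = x ⬝ᵥ (B *ᵥ y)
  rw [mulVec_transpose, dotProduct_comm, dotProduct_mulVec]

/-- The dissipation of one node is nonnegative when the weight on the load and estimation
states dominates the cross terms. -/
lemma node_dissipation_nonneg {g q : ℝ} (hg : 0 < g) (α β x y z w : ℝ)
    (hq : q = (α ^ 2 + β ^ 2) / (2 * g) + 1) :
    0 ≤ g * x ^ 2 + g * y ^ 2 + α * x * z + β * y * z + q * z ^ 2 + q * z * w + q * w ^ 2 := by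
  have hq0 : 0 < q := by rw [hq]; positivity
  have key : g * x ^ 2 + g * y ^ 2 + α * x * z + β * y * z + q * z ^ 2 + q * z * w + q * w ^ 2
      = g * (x + α * z / (2 * g)) ^ 2 + g * (y + β * z / (2 * g)) ^ 2
        + (q - (α ^ 2 + β ^ 2) / (2 * g)) / 2 * z ^ 2
        + q / 2 * (z + w) ^ 2 + q / 2 * w ^ 2 := by
    field_simp
    ring
  have h1 : q - (α ^ 2 + β ^ 2) / (2 * g) = 1 := by rw [hq]; ring
  rw [key, h1]
  positivity

/-- Nodewise and edgewise dissipation inequalities add up to the inequality for the network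
when the interconnection exchanges power without loss. -/
lemma sum_le_of_power_balance {m n : Type*} [Fintype m] [Fintype n]
    {f₁ f₂ f₃ f₄ f₅ f₆ v₁ v₂ v₃ e₁ e₂ : m → ℝ} {g₁ g₂ p₁ p₂ : n → ℝ}
    (h₁ : ∑ k, p₁ k = ∑ i, e₁ i) (h₂ : ∑ k, p₂ k = ∑ i, e₂ i)
    (hnode : ∀ i, 1 / 2 * (f₁ i + f₂ i + f₃ i + f₄ i) + f₅ i + f₆ i - e₁ i - e₂ i
      ≤ v₁ i + v₂ i - 2 * v₃ i)
    (hedge : ∀ k, 1 / 2 * (g₁ k + g₂ k) + p₁ k + p₂ k ≤ 0) :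
    1 / 2 * (∑ i, f₁ i + ∑ i, f₂ i + ∑ i, f₃ i + ∑ i, f₄ i + ∑ k, g₁ k + ∑ k, g₂ k)
      + ∑ i, f₅ i + ∑ i, f₆ i ≤ ∑ i, v₁ i + ∑ i, v₂ i - 2 * ∑ i, v₃ i := by
  have hn := Finset.sum_le_sum fun i (_ : i ∈ Finset.univ) => hnode i
  have he := Finset.sum_nonpos fun k (_ : k ∈ Finset.univ) => hedge k
  simp only [Finset.sum_add_distrib, Finset.sum_sub_distrib, ← Finset.mul_sum] at hn he
  linarith

/-- There exist ζ₁, ζ₂, ζ₃ > 0 and diagonal positive definite Q₁, Q₂ such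
that, with P₁, P₂ the (unique) solutions of the Lyapunov equations
−AᵀP₁ − P₁A + Q₁ = 0 and −(C+D)ᵀP₂ − P₂(C+D) + Q₂ = 0, along every C² solution of the
human-physical system driven by C¹ inputs u_d, u_q, s the storage function S_ph satisfies
d/dt S_ph ≤ İ_tdᵀ u̇_d + İ_tqᵀ u̇_q − 2 ż_lᵀ P₁ A H ṡ (passivity of the HPS). -/
theorem stmt_13 (N E : ℕ) (hN : 1 ≤ N) (hE : 1 ≤ E) (ω : ℝ)
    (ct lt rt rLinv : Fin N → ℝ)
    (hct : ∀ i, 0 < ct i) (hlt : ∀ i, 0 < lt i) (hrt : ∀ i, 0 < rt i)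
    (hrL : ∀ i, 0 < rLinv i)
    (rr ll : Fin E → ℝ) (hrr : ∀ k, 0 < rr k) (hll : ∀ k, 0 < ll k)
    (B : Matrix (Fin N) (Fin E) ℝ)
    (iLd iLq : Fin N → ℝ) (hiLd : ∀ i, 0 ≤ iLd i) (hiLq : ∀ i, iLq i ≤ 0)
    (a h c d pego pbio : Fin N → ℝ)
    (ha : ∀ i, 0 < a i) (hh : ∀ i, 0 ≤ h i ∧ h i ≤ 1)
    (hc : ∀ i, 0 ≤ c i) (hd : ∀ i, 0 ≤ d i) (hcd : ∀ i, 0 < c i + d i)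
    (pbar : Fin N → ℝ)
    (hpbar : ∀ i, pbar i = (c i * pego i + d i * pbio i) / (c i + d i)) :
    ∃ ζ1 ζ2 ζ3 : ℝ, 0 < ζ1 ∧ 0 < ζ2 ∧ 0 < ζ3 ∧
    ∃ q1 q2 : Fin N → ℝ, (∀ i, 0 < q1 i) ∧ (∀ i, 0 < q2 i) ∧
    ∀ P1 P2 : Matrix (Fin N) (Fin N) ℝ,
      -(Matrix.diagonal a)ᵀ * P1 - P1 * Matrix.diagonal a
        + Matrix.diagonal q1 = 0 →
      -(Matrix.diagonal (fun i => c i + d i))ᵀ * P2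
        - P2 * Matrix.diagonal (fun i => c i + d i) + Matrix.diagonal q2 = 0 →
      -- every C² solution of the HPS driven by C¹ inputs u_d, u_q, s
      ∀ (Vd Vq Itd Itq zl pt ud uq s : ℝ → Fin N → ℝ) (Id Iq : ℝ → Fin E → ℝ),
      (∀ i, ContDiff ℝ 2 (fun t => Vd t i) ∧ ContDiff ℝ 2 (fun t => Vq t i) ∧
        ContDiff ℝ 2 (fun t => Itd t i) ∧ ContDiff ℝ 2 (fun t => Itq t i) ∧
        ContDiff ℝ 2 (fun t => zl t i) ∧ ContDiff ℝ 2 (fun t => pt t i)) →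
      (∀ k, ContDiff ℝ 2 (fun t => Id t k) ∧ ContDiff ℝ 2 (fun t => Iq t k)) →
      (∀ i, ContDiff ℝ 1 (fun t => ud t i) ∧ ContDiff ℝ 1 (fun t => uq t i) ∧
        ContDiff ℝ 1 (fun t => s t i)) →
      -- the HPS dynamics
      (∀ i t, ct i * deriv (fun τ => Vd τ i) t =
        -(rLinv i * Vd t i) + ω * ct i * Vq t i + Itd t i + (B *ᵥ Id t) i
        - iLd i * zl t i) →
      (∀ i t, ct i * deriv (fun τ => Vq τ i) t =
        -(ω * ct i * Vd t i) - rLinv i * Vq t i + Itq t i + (B *ᵥ Iq t) i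
        - iLq i * zl t i) →
      (∀ i t, lt i * deriv (fun τ => Itd τ i) t =
        -(Vd t i) - rt i * Itd t i + ω * lt i * Itq t i + ud t i) →
      (∀ i t, lt i * deriv (fun τ => Itq τ i) t =
        -(Vq t i) - ω * lt i * Itd t i - rt i * Itq t i + uq t i) →
      (∀ k t, ll k * deriv (fun τ => Id τ k) t =
        -((Bᵀ *ᵥ Vd t) k) - rr k * Id t k + ω * ll k * Iq t k) →
      (∀ k t, ll k * deriv (fun τ => Iq τ k) t =
        -((Bᵀ *ᵥ Vq t) k) - ω * ll k * Id t k - rr k * Iq t k) →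
      (∀ i t, deriv (fun τ => zl τ i) t =
        a i * (pbar i - pt t i - zl t i - h i * s t i)) →
      (∀ i t, deriv (fun τ => pt τ i) t = -((c i + d i) * pt t i)) →
      -- the storage function S_ph
      ∀ Sph : ℝ → ℝ,
      (∀ t, Sph t = 1 / 2 *
          (∑ i, ct i * (deriv (fun τ => Vd τ i) t) ^ 2
           + ∑ i, ct i * (deriv (fun τ => Vq τ i) t) ^ 2
           + ∑ i, lt i * (deriv (fun τ => Itd τ i) t) ^ 2
           + ∑ i, lt i * (deriv (fun τ => Itq τ i) t) ^ 2
           + ∑ k, ll k * (deriv (fun τ => Id τ k) t) ^ 2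
           + ∑ k, ll k * (deriv (fun τ => Iq τ k) t) ^ 2)
        + ∑ i, ∑ j, deriv (fun τ => zl τ i) t * P1 i j * deriv (fun τ => zl τ j) t
        + ∑ i, ∑ j, deriv (fun τ => pt τ i) t * P2 i j * deriv (fun τ => pt τ j) t) →
      ∀ t : ℝ, ∃ D : ℝ, HasDerivAt Sph D t ∧
        D ≤ ∑ i, deriv (fun τ => Itd τ i) t * deriv (fun τ => ud τ i) t
          + ∑ i, deriv (fun τ => Itq τ i) t * deriv (fun τ => uq τ i) t
          - 2 * ∑ i, ∑ j, deriv (fun τ => zl τ i) t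
              * (P1 * Matrix.diagonal a * Matrix.diagonal h) i j
              * deriv (fun τ => s τ j) t := by
  refine ⟨1, 1, 1, one_pos, one_pos, one_pos,
    fun i => (iLd i ^ 2 + iLq i ^ 2) / (2 * rLinv i) + 1,
    fun i => (iLd i ^ 2 + iLq i ^ 2) / (2 * rLinv i) + 1,
    fun i => ?_, fun i => ?_, ?_⟩
  · have := hrL i
    positivity
  · have := hrL i
    positivity
  intro P1 P2 hP1 hP2 Vd Vq Itd Itq zl pt ud uq s Id Iq hN2 hE2 hu
    eVd eVq eItd eItq eId eIq ezl ept Sph hS t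
  obtain ⟨q, hq⟩ : ∃ q : Fin N → ℝ,
      q = fun i => (iLd i ^ 2 + iLq i ^ 2) / (2 * rLinv i) + 1 := ⟨_, rfl⟩
  rw [← hq] at hP1 hP2
  rw [eq_diagonal_of_lyapunov hcd hP2] at hS
  rw [eq_diagonal_of_lyapunov ha hP1] at hS ⊢
  simp only [diagonal_mul_diagonal, sum_sum_mul_diagonal_mul] at hS ⊢
  have cVd := fun i => (hN2 i).1
  have cVq := fun i => (hN2 i).2.1
  have cItd := fun i => (hN2 i).2.2.1
  have cItq := fun i => (hN2 i).2.2.2.1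
  have czl := fun i => (hN2 i).2.2.2.2.1
  have cpt := fun i => (hN2 i).2.2.2.2.2
  have cId := fun k => (hE2 k).1
  have cIq := fun k => (hE2 k).2
  have dVd := fun i => hasDerivAt_of_contDiff_two (cVd i) t
  have dVq := fun i => hasDerivAt_of_contDiff_two (cVq i) t
  have dItd := fun i => hasDerivAt_of_contDiff_two (cItd i) t
  have dItq := fun i => hasDerivAt_of_contDiff_two (cItq i) t
  have dzl := fun i => hasDerivAt_of_contDiff_two (czl i) t
  have dpt := fun i => hasDerivAt_of_contDiff_two (cpt i) t
  have dId := fun k => hasDerivAt_of_contDiff_two (cId k) t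
  have dIq := fun k => hasDerivAt_of_contDiff_two (cIq k) t
  have dud := fun i => hasDerivAt_of_contDiff_one (hu i).1 t
  have duq := fun i => hasDerivAt_of_contDiff_one (hu i).2.1 t
  have ds := fun i => hasDerivAt_of_contDiff_one (hu i).2.2 t
  have fVd := fun i => mul_deriv_deriv_eq (cVd i) (eVd i)
    ((((((dVd i).const_mul (rLinv i)).fun_neg).fun_add ((dVq i).const_mul (ω * ct i))).fun_add
      (dItd i)).fun_add (hasDerivAt_mulVec_apply B dId i) |>.fun_sub ((dzl i).const_mul (iLd i)))
  have fVq := fun i => mul_deriv_deriv_eq (cVq i) (eVq i)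
    ((((((dVd i).const_mul (ω * ct i)).fun_neg).fun_sub ((dVq i).const_mul (rLinv i))).fun_add
      (dItq i)).fun_add (hasDerivAt_mulVec_apply B dIq i) |>.fun_sub ((dzl i).const_mul (iLq i)))
  have fItd := fun i => mul_deriv_deriv_eq (cItd i) (eItd i)
    (((dVd i).fun_neg.fun_sub ((dItd i).const_mul (rt i))).fun_add
      ((dItq i).const_mul (ω * lt i)) |>.fun_add (dud i))
  have fItq := fun i => mul_deriv_deriv_eq (cItq i) (eItq i)
    (((dVq i).fun_neg.fun_sub ((dItd i).const_mul (ω * lt i))).fun_sub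
      ((dItq i).const_mul (rt i)) |>.fun_add (duq i))
  have fId := fun k => mul_deriv_deriv_eq (cId k) (eId k)
    (((hasDerivAt_mulVec_apply Bᵀ dVd k).fun_neg.fun_sub ((dId k).const_mul (rr k))).fun_add
      ((dIq k).const_mul (ω * ll k)))
  have fIq := fun k => mul_deriv_deriv_eq (cIq k) (eIq k)
    (((hasDerivAt_mulVec_apply Bᵀ dVq k).fun_neg.fun_sub ((dId k).const_mul (ω * ll k))).fun_sub
      ((dIq k).const_mul (rr k)))
  have fzl := fun i => mul_deriv_deriv_eq (c := 1) (czl i)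
    (fun τ => (one_mul _).trans (ezl i τ))
    ((((dpt i).const_sub (pbar i)).fun_sub (dzl i) |>.fun_sub
      ((ds i).const_mul (h i))).const_mul (a i))
  have fpt := fun i => mul_deriv_deriv_eq (c := 1) (cpt i)
    (fun τ => (one_mul _).trans (ept i τ)) ((dpt i).const_mul (c i + d i)).fun_neg
  have hder := ((((((hasDerivAt_sum_mul_sq ct fun i =>
      hasDerivAt_deriv_of_contDiff_two (cVd i) t).fun_add
    (hasDerivAt_sum_mul_sq ct fun i => hasDerivAt_deriv_of_contDiff_two (cVq i) t)).fun_add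
    (hasDerivAt_sum_mul_sq lt fun i => hasDerivAt_deriv_of_contDiff_two (cItd i) t)).fun_add
    (hasDerivAt_sum_mul_sq lt fun i => hasDerivAt_deriv_of_contDiff_two (cItq i) t)).fun_add
    (hasDerivAt_sum_mul_sq ll fun k => hasDerivAt_deriv_of_contDiff_two (cId k) t)).fun_add
    (hasDerivAt_sum_mul_sq ll fun k => hasDerivAt_deriv_of_contDiff_two (cIq k) t)).const_mul
      (1 / 2 : ℝ) |>.fun_add
    (hasDerivAt_sum_mul_sq (fun i => q i / (2 * a i)) fun i =>
      hasDerivAt_deriv_of_contDiff_two (czl i) t) |>.fun_add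
    (hasDerivAt_sum_mul_sq (fun i => q i / (2 * (c i + d i))) fun i =>
      hasDerivAt_deriv_of_contDiff_two (cpt i) t)
  refine ⟨_, hder.congr_of_eventuallyEq (.of_forall fun τ => ?_), ?_⟩
  · rw [hS τ]
    congr 1
    · congr 1
      exact Finset.sum_congr rfl fun i _ => by ring
    · exact Finset.sum_congr rfl fun i _ => by ring
  simp only [one_mul] at fzl fpt
  simp only [fVd, fVq, fItd, fItq, fId, fIq, fzl, fpt]
  refine sum_le_of_power_balance
    (sum_mul_mulVec_transpose B (fun i => deriv (fun τ => Vd τ i) t)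
      fun k => deriv (fun τ => Id τ k) t)
    (sum_mul_mulVec_transpose B (fun i => deriv (fun τ => Vq τ i) t)
      fun k => deriv (fun τ => Iq τ k) t) (fun i => ?_) (fun k => ?_)
  · have hdiss := node_dissipation_nonneg (hrL i) (iLd i) (iLq i)
      (deriv (fun τ => Vd τ i) t) (deriv (fun τ => Vq τ i) t)
      (deriv (fun τ => zl τ i) t) (deriv (fun τ => pt τ i) t) (congrFun hq i)
    have hd' := mul_nonneg (hrt i).le (sq_nonneg (deriv (fun τ => Itd τ i) t))
    have hq' := mul_nonneg (hrt i).le (sq_nonneg (deriv (fun τ => Itq τ i) t))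
    have hz (v : ℝ) : q i / (2 * a i) * (a i * v) = q i * v / 2 := by
      have := ha i
      field_simp
    have hp (v : ℝ) : q i / (2 * (c i + d i)) * -((c i + d i) * v) = -(q i * v / 2) := by
      have := hcd i
      field_simp
    have hs : q i / (2 * a i) * a i * h i = q i * h i / 2 := by
      have := ha i
      field_simp
    rw [hz, hp, hs]
    linarith
  · have hd' := mul_nonneg (hrr k).le (sq_nonneg (deriv (fun τ => Id τ k) t))
    have hq' := mul_nonneg (hrr k).le (sq_nonneg (deriv (fun τ => Iq τ k) t))
    linarith
end
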